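/- Vanishing on the zero-momentum hyperplane at the reduction point: for every odd N ≥ 1 and every admissible tuple X = (x_1,…,x_N) with x_1 + x_2 + … + x_N = 0, the function J̃_N(X) (the exponential-field J function at parameter a = p − 1/2, i.e., with e^{iπa} = −iω) vanishes: J̃_N(X) = 0. -/

import Mathlib

open Finset Filter Complex

/-- The function `f(x) = (x+ω)(x−ω⁻¹)/(x²−1)`. -/
noncomputable def ff (ω x : ℂ) : ℂ := (x + ω) * (x - ω⁻¹) / (x ^ 2 - 1)

/-- The power sum `S_m` (with `m ∈ ℤ`) of the entries `X i`, `i ∈ I`. -/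
noncomputable def pS (m : ℤ) {N : ℕ} (X : Fin N → ℂ) (I : Finset (Fin N)) : ℂ :=
  ∑ i ∈ I, X i ^ m

/-- The polynomial `P^h(X_-|X_+) = ∏_{m=1}^s (S_m(X_-) − (−1)^m S_m(X_+))^{k_m}` of the
partition `h` with multiplicities `k` (with `k m` parts equal to `m`, `1 ≤ m ≤ s`),
evaluated on the entries of `X` indexed by `Im` and `Ip`. -/
noncomputable def Ph (k : ℕ → ℕ) (s : ℕ) {N : ℕ} (X : Fin N → ℂ)
    (Im Ip : Finset (Fin N)) : ℂ :=
  ∏ m ∈ Finset.Icc 1 s, (pS (m : ℤ) X Im - (-1 : ℂ) ^ m * pS (m : ℤ) X Ip) ^ k m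

/-- A tuple is admissible if all entries are nonzero and `x_i ≠ ±x_j` for `i ≠ j`. -/
def Admissible {N : ℕ} (X : Fin N → ℂ) : Prop :=
  (∀ i, X i ≠ 0) ∧ ∀ i j, i ≠ j → X i ≠ X j ∧ X i ≠ -X j

/-- The phase factor `e^{iπa(#I_- − #I_+)}` where `#I_- = c`, `#I_+ = N − c`. -/
noncomputable def phase (a : ℂ) (N c : ℕ) : ℂ :=
  Complex.exp (Complex.I * (Real.pi : ℂ) * a * (2 * (c : ℂ) - (N : ℂ)))

/-- The descendant function
`J^h_{N,a}(X) = Σ_{I_- ⊔ I_+} e^{iπa(#I_- − #I_+)} P^h(X_-|X_+) ∏_{i∈I_-, j∈I_+} f(x_i/x_j)`. -/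
noncomputable def J (ω : ℂ) (k : ℕ → ℕ) (s : ℕ) (a : ℂ) {N : ℕ} (X : Fin N → ℂ) : ℂ :=
  ∑ I : Finset (Fin N),
    phase a N I.card * Ph k s X I Iᶜ * ∏ i ∈ I, ∏ j ∈ Iᶜ, ff ω (X i / X j)

/-- The exponential-field function `J_{N,a}(X)` (the case `P^h = 1`). -/
noncomputable def Jexp (ω a : ℂ) {N : ℕ} (X : Fin N → ℂ) : ℂ :=
  ∑ I : Finset (Fin N),
    phase a N I.card * ∏ i ∈ I, ∏ j ∈ Iᶜ, ff ω (X i / X j)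

/-- The function `J̃_N(X)`: the exponential-field `J` function at the parameter value
`a = p − 1/2`, i.e. with `e^{iπa}` replaced by `−iω`. -/
noncomputable def Jtilde (ω : ℂ) {N : ℕ} (X : Fin N → ℂ) : ℂ :=
  ∑ I : Finset (Fin N),
    (-(Complex.I * ω)) ^ (2 * (I.card : ℤ) - (N : ℤ)) *
      ∏ i ∈ I, ∏ j ∈ Iᶜ, ff ω (X i / X j)

open Topology Bornology

/-- A function that is holomorphic off a finite set, has at most removable singularities there and
tends to zero at infinity vanishes off that set. -/
theorem eq_zero_of_removable_of_tendsto_cobounded (P : Finset ℂ) (T : ℂ → ℂ)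
    (hd : ∀ z ∉ P, DifferentiableAt ℂ T z)
    (hP : ∀ p ∈ P, Tendsto (fun z => (z - p) * T z) (𝓝[≠] p) (𝓝 0))
    (hT : Tendsto T (cobounded ℂ) (𝓝 0)) : ∀ z ∉ P, T z = 0 := by
  induction P using Finset.induction_on generalizing T with
  | empty =>
    intro z _
    exact Differentiable.apply_eq_of_tendsto_cocompact (fun z => hd z (by simp)) z
      (by rwa [← Metric.cobounded_eq_cocompact])
  | insert p P hp ih =>
    intro z hz
    rw [Finset.mem_insert, not_or] at hz
    set T' := Function.update T p (limUnder (𝓝[≠] p) T) with hT'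
    have heq : ∀ w ≠ p, T' w = T w := fun w hw => Function.update_of_ne hw _ _
    have heq' : ∀ w ≠ p, T' =ᶠ[𝓝 w] T := fun w hw => by
      filter_upwards [isOpen_ne.mem_nhds hw] with v hv using heq v hv
    rw [← heq z hz.1]
    refine ih T' ?_ ?_ ?_ z hz.2
    · intro w hw
      have hopen : IsOpen ((P : Set ℂ)ᶜ) := P.finite_toSet.isClosed.isOpen_compl
      by_cases hwp : w = p
      · subst hwp
        have := Complex.differentiableOn_update_limUnder_of_isLittleO (f := T)
          (s := (P : Set ℂ)ᶜ) (c := w) (hopen.mem_nhds (by simpa using hw))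
          (fun v hv => (hd v (by
            simp only [Set.mem_sdiff, Set.mem_compl_iff, Finset.mem_coe,
              Set.mem_singleton_iff] at hv
            simp [hv.1, hv.2])).differentiableWithinAt) ?_
        · exact this.differentiableAt (hopen.mem_nhds (by simpa using hw))
        · have hlim : Tendsto (fun z => (z - w) * (T z - T w)) (𝓝[≠] w) (𝓝 0) := by
            have h1 : Tendsto (fun z : ℂ => (z - w) * T w) (𝓝[≠] w) (𝓝 0) := by
              have : Tendsto (fun z : ℂ => (z - w) * T w) (𝓝 w) (𝓝 ((w - w) * T w)) :=
                Continuous.tendsto (by fun_prop) w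
              rw [sub_self, zero_mul] at this
              exact this.mono_left nhdsWithin_le_nhds
            simpa [mul_sub] using (hP w (by simp)).sub h1
          rw [Asymptotics.isLittleO_iff_tendsto']
          · refine hlim.congr fun z => ?_
            rw [div_inv_eq_mul, mul_comm]
          · filter_upwards [self_mem_nhdsWithin] with z hz h
            exact absurd h (inv_ne_zero (sub_ne_zero.2 hz))
      · exact (hd w (by simp [hw, hwp])).congr_of_eventuallyEq (heq' w hwp)
    · intro w hw
      have hwp : w ≠ p := fun h => hp (h ▸ hw)
      refine (hP w (by simp [hw])).congr' ?_
      filter_upwards [nhdsWithin_le_nhds (heq' w hwp)] with v hv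
      rw [hv]
    · refine hT.congr' ?_
      filter_upwards [isBounded_def.1 (isBounded_singleton (x := p))]
        with v hv using (heq v hv).symm

/-- The two-body factor, `f(a/b)` written as a function of `a` and `b`. -/
noncomputable def pairFactor (δ a b : ℂ) : ℂ := 1 + δ * a * b / (a ^ 2 - b ^ 2)

theorem pairFactor_neg_left (δ a b : ℂ) : pairFactor δ (-a) b = pairFactor δ b a := by
  unfold pairFactor
  rw [neg_sq, ← neg_sub (b ^ 2), div_neg, mul_neg, neg_mul, neg_div, neg_neg, mul_right_comm]

theorem Filter.Tendsto.pairFactor {α : Type*} {l : Filter α} {δ : ℂ} {u v : α → ℂ} {a b : ℂ}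
    (hu : Tendsto u l (𝓝 a)) (hv : Tendsto v l (𝓝 b)) (hab : a ^ 2 ≠ b ^ 2) :
    Tendsto (fun t => pairFactor δ (u t) (v t)) l (𝓝 (pairFactor δ a b)) :=
  ((((hu.const_mul δ).mul hv).div ((hu.pow 2).sub (hv.pow 2)) (sub_ne_zero.2 hab))).const_add 1

/-- The entries of `x` indexed by `U` have pairwise distinct squares. -/
def SqDistinct {ι : Type*} (x : ι → ℂ) (U : Finset ι) : Prop :=
  ∀ i ∈ U, ∀ j ∈ U, i ≠ j → x i ^ 2 ≠ x j ^ 2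

theorem SqDistinct.mono {ι : Type*} {x : ι → ℂ} {U V : Finset ι} (h : SqDistinct x U) (hV : V ⊆ U) :
    SqDistinct x V := fun i hi j hj => h i (hV hi) j (hV hj)

theorem SqDistinct.congr {ι : Type*} {x y : ι → ℂ} {R : Finset ι} (hR : SqDistinct x R)
    (h : ∀ i ∈ R, y i = x i) : SqDistinct y R := fun i hi j hj hij => by
  rw [h i hi, h j hj]
  exact hR i hi j hj hij

section SplitSum

variable {ι : Type*} [DecidableEq ι]

/-- The weight of the decomposition `I ⊔ (U \ I)` of `U`. -/
noncomputable def splitWeight (δ : ℂ) (x : ι → ℂ) (U I : Finset ι) : ℂ :=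
  ∏ i ∈ I, ∏ j ∈ U \ I, pairFactor δ (x i) (x j)

/-- The sum over decompositions of `U`, with fugacity `b` per element of the first part. -/
noncomputable def splitSum (δ b : ℂ) (x : ι → ℂ) (U : Finset ι) : ℂ :=
  ∑ I ∈ U.powerset, b ^ #I * splitWeight δ x U I

/-- The contribution to `splitSum` of two extra points, given the decomposition of the rest `R`
into `I` and `R \ I`. -/
noncomputable def pairBracket (δ b : ℂ) (x : ι → ℂ) (p q : ι) (R I : Finset ι) : ℂ :=
  b ^ 2 * ((∏ j ∈ R \ I, pairFactor δ (x p) (x j)) * ∏ j ∈ R \ I, pairFactor δ (x q) (x j)) +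
  (∏ i ∈ I, pairFactor δ (x i) (x p)) * (∏ i ∈ I, pairFactor δ (x i) (x q)) +
  b * (pairFactor δ (x p) (x q) *
      ((∏ j ∈ R \ I, pairFactor δ (x p) (x j)) * ∏ i ∈ I, pairFactor δ (x i) (x q)) +
    pairFactor δ (x q) (x p) *
      ((∏ j ∈ R \ I, pairFactor δ (x q) (x j)) * ∏ i ∈ I, pairFactor δ (x i) (x p)))

theorem splitWeight_insert_right (δ : ℂ) (x : ι → ℂ) {U I : Finset ι} {p : ι} (hp : p ∉ U)
    (hI : I ⊆ U) : splitWeight δ x (insert p U) I =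
      splitWeight δ x U I * ∏ i ∈ I, pairFactor δ (x i) (x p) := by
  unfold splitWeight
  rw [Finset.insert_sdiff_of_notMem _ (fun h => hp (hI h)), ← Finset.prod_mul_distrib]
  refine Finset.prod_congr rfl fun i _ => ?_
  rw [Finset.prod_insert (fun h => hp (Finset.mem_sdiff.1 h).1), mul_comm]

theorem splitWeight_insert_left (δ : ℂ) (x : ι → ℂ) {U I : Finset ι} {p : ι} (hp : p ∉ U)
    (hI : I ⊆ U) : splitWeight δ x (insert p U) (insert p I) =
      splitWeight δ x U I * ∏ j ∈ U \ I, pairFactor δ (x p) (x j) := by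
  have h : insert p U \ insert p I = U \ I := by
    ext i
    simp only [Finset.mem_sdiff, Finset.mem_insert]
    by_cases hi : i = p
    · subst hi
      simp [hp]
    · simp [hi]
  unfold splitWeight
  rw [h, Finset.prod_insert (fun h => hp (hI h)), mul_comm]

theorem splitSum_insert_insert (δ b : ℂ) (x : ι → ℂ) {p q : ι} {R : Finset ι} (hpq : p ≠ q)
    (hp : p ∉ R) (hq : q ∉ R) : splitSum δ b x (insert p (insert q R)) =
      ∑ I ∈ R.powerset, b ^ #I * splitWeight δ x R I * pairBracket δ b x p q R I := by
  have hp' : p ∉ insert q R := by simp [hpq, hp]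
  unfold splitSum
  rw [Finset.sum_powerset_insert hp', Finset.sum_powerset_insert hq,
    Finset.sum_powerset_insert hq, ← Finset.sum_add_distrib, ← Finset.sum_add_distrib,
    ← Finset.sum_add_distrib]
  refine Finset.sum_congr rfl fun I hI => ?_
  rw [Finset.mem_powerset] at hI
  have hpI : p ∉ I := fun h => hp (hI h)
  have hqI : q ∉ I := fun h => hq (hI h)
  have hsub : I ⊆ insert q R := hI.trans (Finset.subset_insert _ _)
  have hsub' : insert q I ⊆ insert q R := Finset.insert_subset_insert _ hI
  have hpqI : p ∉ insert q I := by simp [hpq, hpI]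
  have hsd : insert q R \ insert q I = R \ I := by
    ext i
    simp only [Finset.mem_sdiff, Finset.mem_insert]
    by_cases hi : i = q
    · subst hi
      simp [hq]
    · simp [hi]
  rw [splitWeight_insert_right δ x hp' hsub, splitWeight_insert_right δ x hp' hsub',
    splitWeight_insert_left δ x hp' hsub, splitWeight_insert_left δ x hp' hsub',
    splitWeight_insert_right δ x hq hI, splitWeight_insert_left δ x hq hI,
    Finset.card_insert_of_notMem hpqI, Finset.card_insert_of_notMem hpI,
    Finset.card_insert_of_notMem hqI, Finset.prod_insert hqI,
    hsd, Finset.insert_sdiff_of_notMem _ hqI,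
    Finset.prod_insert (fun h => hq (Finset.mem_sdiff.1 h).1)]
  unfold pairBracket
  ring

theorem tendsto_splitWeight {α : Type*} {l : Filter α} {δ : ℂ} {x : α → ι → ℂ} {x₀ : ι → ℂ}
    {U I : Finset ι} (hx : ∀ i ∈ U, Tendsto (fun t => x t i) l (𝓝 (x₀ i)))
    (hU : SqDistinct x₀ U) (hI : I ⊆ U) :
    Tendsto (fun t => splitWeight δ (x t) U I) l (𝓝 (splitWeight δ x₀ U I)) := by
  refine tendsto_finsetProd _ fun i hi => tendsto_finsetProd _ fun j hj => ?_
  rw [Finset.mem_sdiff] at hj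
  exact (hx i (hI hi)).pairFactor (hx j hj.1)
    (hU i (hI hi) j hj.1 fun h => hj.2 (h ▸ hi))

theorem tendsto_splitSum {α : Type*} {l : Filter α} {δ b : ℂ} {x : α → ι → ℂ} {x₀ : ι → ℂ}
    {U : Finset ι} (hx : ∀ i ∈ U, Tendsto (fun t => x t i) l (𝓝 (x₀ i)))
    (hU : SqDistinct x₀ U) :
    Tendsto (fun t => splitSum δ b (x t) U) l (𝓝 (splitSum δ b x₀ U)) :=
  tendsto_finsetSum _ fun _ hI =>
    (tendsto_splitWeight hx hU (Finset.mem_powerset.1 hI)).const_mul _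

theorem differentiableAt_splitSum {δ b : ℂ} {x : ℂ → ι → ℂ} {z : ℂ} {U : Finset ι}
    (hx : ∀ i ∈ U, DifferentiableAt ℂ (fun t => x t i) z) (hU : SqDistinct (x z) U) :
    DifferentiableAt ℂ (fun t => splitSum δ b (x t) U) z := by
  unfold splitSum splitWeight
  refine DifferentiableAt.fun_sum fun I hI => DifferentiableAt.const_mul ?_ _
  rw [Finset.mem_powerset] at hI
  refine DifferentiableAt.fun_finsetProd fun i hi => DifferentiableAt.fun_finsetProd fun j hj => ?_
  rw [Finset.mem_sdiff] at hj
  have h := sub_ne_zero.2 (hU i (hI hi) j hj.1 fun h => hj.2 (h ▸ hi))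
  have hi' := hx i (hI hi)
  have hj' := hx j hj.1
  unfold pairFactor
  exact (((hi'.const_mul δ).mul hj').div ((hi'.pow 2).sub (hj'.pow 2)) h).const_add 1

/-- Near `x p = ε * x q` with `ε = ±1`, the two-body factor has a simple pole. -/
theorem tendsto_mul_pairFactor {α : Type*} {l : Filter α} {δ ε a b : ℂ} {u v : α → ℂ}
    (hε : ε ^ 2 = 1) (hu : Tendsto u l (𝓝 a)) (hv : Tendsto v l (𝓝 b)) (hab : a = ε * b)
    (hb : b ≠ 0) (hne : ∀ᶠ t in l, u t - ε * v t ≠ 0) :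
    Tendsto (fun t => (u t - ε * v t) * pairFactor δ (u t) (v t)) l (𝓝 (δ * b / 2)) := by
  have hε0 : ε ≠ 0 := fun h => by simp [h] at hε
  have ha : a + ε * b ≠ 0 := by
    rw [hab, ← two_mul]
    exact mul_ne_zero two_ne_zero (mul_ne_zero hε0 hb)
  have hsum : Tendsto (fun t => u t + ε * v t) l (𝓝 (a + ε * b)) := hu.add (hv.const_mul ε)
  have hlim := (hu.sub (hv.const_mul ε)).add (((hu.const_mul δ).mul hv).div hsum ha)
  have hval : a - ε * b + δ * a * b / (a + ε * b) = δ * b / 2 := by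
    subst hab
    field_simp
    ring
  rw [hval] at hlim
  refine hlim.congr' ?_
  filter_upwards [hne, hsum.eventually_ne ha] with t h1 h2
  have h3 : u t ^ 2 - v t ^ 2 = (u t - ε * v t) * (u t + ε * v t) := by
    linear_combination (v t ^ 2) * hε
  simp only [pairFactor, Pi.div_apply]
  rw [h3]
  field_simp

/-- `splitSum` has no pole at `x p = x q`, and none at `x p = -x q` if it vanishes on the
remaining points. -/
theorem tendsto_mul_splitSum_zero {α : Type*} {l : Filter α} {δ b ε : ℂ} {x : α → ι → ℂ}
    {x₀ : ι → ℂ} {p q : ι} {R : Finset ι} (hpq : p ≠ q) (hp : p ∉ R) (hq : q ∉ R)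
    (hx : ∀ i ∈ insert p (insert q R), Tendsto (fun t => x t i) l (𝓝 (x₀ i)))
    (hR : SqDistinct x₀ (insert q R)) (hq0 : x₀ q ≠ 0) (hpq0 : x₀ p = ε * x₀ q)
    (hne : ∀ᶠ t in l, x t p - ε * x t q ≠ 0)
    (hε : ε = 1 ∨ ε = -1 ∧ splitSum δ b x₀ R = 0) :
    Tendsto (fun t => (x t p - ε * x t q) * splitSum δ b (x t) (insert p (insert q R))) l
      (𝓝 0) := by
  have hε2 : ε ^ 2 = 1 := by rcases hε with h | ⟨h, -⟩ <;> simp [h]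
  have hεε : ε * ε = 1 := by rw [← sq, hε2]
  have hxp := hx p (by simp)
  have hxq := hx q (by simp)
  have hxR : ∀ i ∈ R, Tendsto (fun t => x t i) l (𝓝 (x₀ i)) := fun i hi => hx i (by simp [hi])
  have hsq : x₀ p ^ 2 = x₀ q ^ 2 := by rw [hpq0, mul_pow, hε2, one_mul]
  have hqR : ∀ i ∈ R, x₀ q ^ 2 ≠ x₀ i ^ 2 := fun i hi =>
    hR q (by simp) i (by simp [hi]) fun h => hq (h ▸ hi)
  have hpR : ∀ i ∈ R, x₀ p ^ 2 ≠ x₀ i ^ 2 := fun i hi => hsq ▸ hqR i hi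
  have hd0 : Tendsto (fun t => x t p - ε * x t q) l (𝓝 0) := by
    have := hxp.sub (hxq.const_mul ε)
    rwa [hpq0, sub_self] at this
  have hpqF := tendsto_mul_pairFactor (δ := δ) hε2 hxp hxq hpq0 hq0 hne
  have hqpF : Tendsto (fun t => (x t p - ε * x t q) * pairFactor δ (x t q) (x t p)) l
      (𝓝 (-(δ * x₀ q / 2))) := by
    have hp0 : x₀ p ≠ 0 := fun h => hq0 (by simpa [h] using hsq.symm)
    have h := (tendsto_mul_pairFactor (δ := δ) (ε := ε) hε2 hxq hxp
      (by rw [hpq0, ← mul_assoc, hεε, one_mul]) hp0 (hne.mono fun t ht h => ht (by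
        linear_combination (-ε) * h - (x t p) * hεε))).const_mul (-ε)
    have hval : -ε * (δ * x₀ p / 2) = -(δ * x₀ q / 2) := by
      rw [hpq0]
      linear_combination (-(δ * x₀ q / 2)) * hεε
    rw [hval] at h
    refine h.congr fun t => ?_
    linear_combination (x t p * pairFactor δ (x t q) (x t p)) * hεε
  have hprodL : ∀ {k : ι}, Tendsto (fun t => x t k) l (𝓝 (x₀ k)) →
      (∀ i ∈ R, x₀ k ^ 2 ≠ x₀ i ^ 2) → ∀ I ⊆ R,
      Tendsto (fun t => ∏ j ∈ I, pairFactor δ (x t k) (x t j)) l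
        (𝓝 (∏ j ∈ I, pairFactor δ (x₀ k) (x₀ j))) := fun hk hkR I hI =>
    tendsto_finsetProd _ fun j hj => hk.pairFactor (hxR j (hI hj)) (hkR j (hI hj))
  have hprodR : ∀ {k : ι}, Tendsto (fun t => x t k) l (𝓝 (x₀ k)) →
      (∀ i ∈ R, x₀ k ^ 2 ≠ x₀ i ^ 2) → ∀ I ⊆ R,
      Tendsto (fun t => ∏ j ∈ I, pairFactor δ (x t j) (x t k)) l
        (𝓝 (∏ j ∈ I, pairFactor δ (x₀ j) (x₀ k))) := fun hk hkR I hI =>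
    tendsto_finsetProd _ fun j hj => (hxR j (hI hj)).pairFactor hk (hkR j (hI hj)).symm
  have key : ∀ I ∈ R.powerset, Tendsto (fun t => b ^ #I * splitWeight δ (x t) R I *
      ((x t p - ε * x t q) * pairBracket δ b (x t) p q R I)) l
      (𝓝 (b ^ #I * splitWeight δ x₀ R I * (b * (δ * x₀ q / 2) *
        ((∏ j ∈ R \ I, pairFactor δ (x₀ p) (x₀ j)) * ∏ i ∈ I, pairFactor δ (x₀ i) (x₀ q) -
        (∏ j ∈ R \ I, pairFactor δ (x₀ q) (x₀ j)) * ∏ i ∈ I, pairFactor δ (x₀ i) (x₀ p))))) := by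
    intro I hI
    rw [Finset.mem_powerset] at hI
    refine ((tendsto_splitWeight hxR (hR.mono (Finset.subset_insert _ _)) hI).const_mul _).mul ?_
    have hA := hprodL hxp hpR _ (Finset.sdiff_subset (s := R) (t := I))
    have hB := hprodL hxq hqR _ (Finset.sdiff_subset (s := R) (t := I))
    have hC := hprodR hxp hpR I hI
    have hD := hprodR hxq hqR I hI
    have h := ((hd0.mul (((hA.mul hB).const_mul (b ^ 2)).add (hC.mul hD))).add
      (((hpqF.mul (hA.mul hD)).add (hqpF.mul (hB.mul hC))).const_mul b))
    convert! h using 2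
    · unfold pairBracket
      ring
    · ring
  have hlim := tendsto_finsetSum _ key
  have hzero : (∑ I ∈ R.powerset, b ^ #I * splitWeight δ x₀ R I * (b * (δ * x₀ q / 2) *
        ((∏ j ∈ R \ I, pairFactor δ (x₀ p) (x₀ j)) * ∏ i ∈ I, pairFactor δ (x₀ i) (x₀ q) -
        (∏ j ∈ R \ I, pairFactor δ (x₀ q) (x₀ j)) * ∏ i ∈ I, pairFactor δ (x₀ i) (x₀ p)))) = 0 := by
    rcases hε with rfl | ⟨rfl, hS⟩
    · rw [one_mul] at hpq0
      simp [hpq0]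
    · have hp' : x₀ p = -x₀ q := by rw [hpq0]; ring
      have hq' : x₀ q = -x₀ p := by rw [hp', neg_neg]
      have hflipq : ∀ i, pairFactor δ (x₀ i) (x₀ q) = pairFactor δ (x₀ p) (x₀ i) := fun i => by
        rw [hp', pairFactor_neg_left]
      have hflipp : ∀ i, pairFactor δ (x₀ i) (x₀ p) = pairFactor δ (x₀ q) (x₀ i) := fun i => by
        rw [hq', pairFactor_neg_left]
      calc _ = ∑ I ∈ R.powerset, b ^ #I * splitWeight δ x₀ R I * (b * (δ * x₀ q / 2) *
              ((∏ j ∈ R, pairFactor δ (x₀ p) (x₀ j)) - ∏ j ∈ R, pairFactor δ (x₀ q) (x₀ j))) := by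
            refine Finset.sum_congr rfl fun I hI => ?_
            rw [Finset.mem_powerset] at hI
            simp only [hflipq, hflipp]
            rw [Finset.prod_sdiff hI, Finset.prod_sdiff hI]
        _ = 0 := by
            rw [← Finset.sum_mul]
            unfold splitSum at hS
            rw [hS, zero_mul]
  rw [hzero] at hlim
  refine hlim.congr fun t => ?_
  rw [splitSum_insert_insert δ b (x t) hpq hp hq, Finset.mul_sum]
  exact Finset.sum_congr rfl fun I _ => by ring

theorem tendsto_div_add_cobounded (a : ℂ) :
    Tendsto (fun v : ℂ => v / (v + a)) (cobounded ℂ) (𝓝 1) := by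
  have hadd : Tendsto (fun v : ℂ => v + a) (cobounded ℂ) (cobounded ℂ) :=
    tendsto_add_const_cobounded a
  have h := ((tendsto_inv₀_cobounded.comp hadd).const_mul a).const_sub 1
  rw [mul_zero, sub_zero] at h
  refine h.congr' ?_
  filter_upwards [hadd.eventually_ne_cobounded 0] with v hv
  simp only [Function.comp_apply]
  field_simp
  ring

/-- First-order behaviour of the two-body factor at infinity. -/
theorem tendsto_mul_pairFactor_sub_one (δ c r : ℂ) :
    Tendsto (fun v : ℂ => v * (pairFactor δ (v + c) r - 1)) (cobounded ℂ) (𝓝 (δ * r)) := by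
  have hadd : Tendsto (fun v : ℂ => v + c) (cobounded ℂ) (cobounded ℂ) :=
    tendsto_add_const_cobounded c
  have h := ((tendsto_div_add_cobounded (c - r)).mul
    ((tendsto_div_add_cobounded r).comp hadd)).const_mul (δ * r)
  rw [mul_one, mul_one] at h
  refine h.congr fun v => ?_
  simp only [Function.comp_apply, pairFactor]
  have : (v + c) ^ 2 - r ^ 2 = (v + (c - r)) * (v + c + r) := by ring
  rw [this, div_mul_div_comm]
  ring

/-- If `g k = 1 + c k / v + o(1 / v)` at infinity, then
`∏ g k = 1 + (∑ c k) / v + o(1 / v)`. -/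
theorem tendsto_mul_prod_sub_one (I : Finset ι) (g : ι → ℂ → ℂ) (c : ι → ℂ)
    (h : ∀ k ∈ I, Tendsto (fun v => v * (g k v - 1)) (cobounded ℂ) (𝓝 (c k))) :
    Tendsto (fun v => v * (∏ k ∈ I, g k v - 1)) (cobounded ℂ) (𝓝 (∑ k ∈ I, c k)) := by
  induction I using Finset.induction_on with
  | empty => simp
  | insert k I hk ih =>
    have h1 := h k (by simp)
    have h2 := ih fun j hj => h j (by simp [hj])
    have h3 := (h1.add h2).add (h1.mul (tendsto_inv₀_cobounded.mul h2))
    rw [zero_mul, mul_zero, add_zero] at h3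
    rw [Finset.sum_insert hk]
    refine h3.congr' ?_
    filter_upwards [eventually_ne_cobounded 0] with v hv
    rw [Finset.prod_insert hk]
    field_simp
    ring

theorem tendsto_one_of_tendsto_mul_sub_one {g : ℂ → ℂ} {c : ℂ}
    (h : Tendsto (fun v => v * (g v - 1)) (cobounded ℂ) (𝓝 c)) :
    Tendsto g (cobounded ℂ) (𝓝 1) := by
  have h1 := (tendsto_inv₀_cobounded.mul h).add_const 1
  rw [zero_mul, zero_add] at h1
  refine h1.congr' ?_
  filter_upwards [eventually_ne_cobounded 0] with v hv
  field_simp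
  ring

/-- The configuration with `s / 2 + v` at `p`, `s / 2 - v` at `q` and `r` elsewhere. -/
noncomputable def pairConfig (r : ι → ℂ) (p q : ι) (s v : ℂ) : ι → ℂ :=
  Function.update (Function.update r q (s / 2 - v)) p (s / 2 + v)

theorem pairConfig_left (r : ι → ℂ) (p q : ι) (s v : ℂ) : pairConfig r p q s v p = s / 2 + v := by
  simp [pairConfig]

theorem pairConfig_right (r : ι → ℂ) {p q : ι} (hpq : p ≠ q) (s v : ℂ) :
    pairConfig r p q s v q = s / 2 - v := by
  simp [pairConfig, hpq.symm]

theorem pairConfig_of_ne (r : ι → ℂ) {p q i : ι} (hp : i ≠ p) (hq : i ≠ q) (s v : ℂ) :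
    pairConfig r p q s v i = r i := by
  simp [pairConfig, hp, hq]

/-- If the total momentum is zero, `splitSum` tends to zero when two of the points go to
infinity with a fixed nonzero sum. -/
theorem tendsto_splitSum_pairConfig {δ b : ℂ} (hb : 1 + b ^ 2 + b * (2 + δ ^ 2) = 0)
    {r : ι → ℂ} {p q : ι} {R : Finset ι} {s : ℂ} (hpq : p ≠ q) (hp : p ∉ R) (hq : q ∉ R)
    (hs : s + ∑ k ∈ R, r k = 0) (hs0 : s ≠ 0) :
    Tendsto (fun v => splitSum δ b (pairConfig r p q s v) (insert p (insert q R)))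
      (cobounded ℂ) (𝓝 0) := by
  have hR : ∀ i ∈ R, ∀ v, pairConfig r p q s v i = r i := fun i hi v =>
    pairConfig_of_ne r (ne_of_mem_of_not_mem hi hp) (ne_of_mem_of_not_mem hi hq) s v
  have hneg : Tendsto (fun v : ℂ => -v) (cobounded ℂ) (cobounded ℂ) := tendsto_neg_cobounded
  have hflip : ∀ {g : ℂ → ℂ} {c : ℂ}, Tendsto (fun v => v * (g v - 1)) (cobounded ℂ) (𝓝 c) →
      Tendsto (fun v => v * (g (-v) - 1)) (cobounded ℂ) (𝓝 (-c)) := fun h =>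
    (h.comp hneg).neg.congr fun v => by simp
  have hL : ∀ c k, Tendsto (fun v : ℂ => v * (pairFactor δ (v + c) (r k) - 1)) (cobounded ℂ)
      (𝓝 (δ * r k)) := fun c k => tendsto_mul_pairFactor_sub_one δ c (r k)
  have hLp : ∀ k, Tendsto (fun v : ℂ => v * (pairFactor δ (s / 2 + v) (r k) - 1)) (cobounded ℂ)
      (𝓝 (δ * r k)) := fun k => (hL (s / 2) k).congr fun v => by rw [add_comm]
  have hRq : ∀ k, Tendsto (fun v : ℂ => v * (pairFactor δ (r k) (s / 2 - v) - 1)) (cobounded ℂ)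
      (𝓝 (δ * r k)) := fun k => (hL (-(s / 2)) k).congr fun v => by
    rw [← pairFactor_neg_left δ (s / 2 - v), neg_sub, sub_eq_add_neg v]
  have hLq : ∀ k, Tendsto (fun v : ℂ => v * (pairFactor δ (s / 2 - v) (r k) - 1)) (cobounded ℂ)
      (𝓝 (-(δ * r k))) := fun k => (hflip (hLp k)).congr fun v => by rw [sub_eq_add_neg (s / 2)]
  have hRp : ∀ k, Tendsto (fun v : ℂ => v * (pairFactor δ (r k) (s / 2 + v) - 1)) (cobounded ℂ)
      (𝓝 (-(δ * r k))) := fun k => (hflip (hRq k)).congr fun v => by rw [sub_neg_eq_add]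
  have hcoef : Tendsto (fun v : ℂ => δ / (2 * s) * (s ^ 2 / 4 * (v⁻¹ * v⁻¹) - 1)) (cobounded ℂ)
      (𝓝 (-(δ / (2 * s)))) := by
    have hinv : Tendsto (fun v : ℂ => v⁻¹) (cobounded ℂ) (𝓝 0) := tendsto_inv₀_cobounded
    have := (((hinv.mul hinv).const_mul (s ^ 2 / 4)).sub_const 1).const_mul (δ / (2 * s))
    simpa using this
  have hbr : ∀ I ⊆ R, Tendsto (fun v => pairBracket δ b (pairConfig r p q s v) p q R I)
      (cobounded ℂ) (𝓝 0) := by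
    intro I hI
    have one {J : Finset ι} {g : ι → ℂ → ℂ} {c : ι → ℂ}
        (h : ∀ k, Tendsto (fun v => v * (g k v - 1)) (cobounded ℂ) (𝓝 (c k))) :
        Tendsto (fun v => ∏ k ∈ J, g k v) (cobounded ℂ) (𝓝 1) :=
      tendsto_one_of_tendsto_mul_sub_one (tendsto_mul_prod_sub_one J g c fun k _ => h k)
    have glue {g g' : ι → ℂ → ℂ} {c : ι → ℂ}
        (h : ∀ k, Tendsto (fun v => v * (g k v - 1)) (cobounded ℂ) (𝓝 (c k)))
        (h' : ∀ k, Tendsto (fun v => v * (g' k v - 1)) (cobounded ℂ) (𝓝 (c k))) :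
        Tendsto (fun v => v * ((∏ k ∈ R \ I, g k v) * (∏ k ∈ I, g' k v) - 1)) (cobounded ℂ)
          (𝓝 (∑ k ∈ R, c k)) := by
      have h1 := tendsto_mul_prod_sub_one (R \ I) g c fun k _ => h k
      have h2 := tendsto_mul_prod_sub_one I g' c fun k _ => h' k
      have h3 := (h1.mul (one (J := I) h')).add h2
      rw [mul_one, Finset.sum_sdiff hI] at h3
      exact h3.congr fun v => by ring
    have hA := glue hLp hRq
    have hA' := glue hLq hRp
    have hA1 := tendsto_one_of_tendsto_mul_sub_one hA
    have hA1' := tendsto_one_of_tendsto_mul_sub_one hA'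
    have hlim := ((((one (J := R \ I) hLp).mul (one (J := R \ I) hLq)).const_mul (b ^ 2)).add
      ((one (J := I) hRp).mul (one (J := I) hRq))).add
        (((hA1.add hA1').add (hcoef.mul (hA.sub hA'))).const_mul b)
    have hval : b ^ 2 * (1 * 1) + 1 * 1 + b * (1 + 1 + -(δ / (2 * s)) *
        (∑ k ∈ R, δ * r k - ∑ k ∈ R, -(δ * r k))) = 0 := by
      have hsum : ∑ k ∈ R, r k = -s := by linear_combination hs
      rw [Finset.sum_neg_distrib, ← Finset.mul_sum, hsum]
      field_simp
      linear_combination 2 * hb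
    rw [hval] at hlim
    refine hlim.congr' ?_
    filter_upwards [eventually_ne_cobounded 0] with v hv
    have hpF : pairFactor δ (s / 2 + v) (s / 2 - v) =
        1 + δ / (2 * s) * (s ^ 2 / 4 * (v⁻¹ * v⁻¹) - 1) * v := by
      have : (s / 2 + v) ^ 2 - (s / 2 - v) ^ 2 = 2 * s * v := by ring
      rw [pairFactor, this]
      field_simp
      ring
    have hqF : pairFactor δ (s / 2 - v) (s / 2 + v) =
        1 - δ / (2 * s) * (s ^ 2 / 4 * (v⁻¹ * v⁻¹) - 1) * v := by
      have : (s / 2 - v) ^ 2 - (s / 2 + v) ^ 2 = -(2 * s * v) := by ring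
      rw [pairFactor, this]
      field_simp
      ring
    have hcongr : ∀ J ⊆ R, ∀ F : ℂ → ℂ, ∏ j ∈ J, F (pairConfig r p q s v j) =
        ∏ j ∈ J, F (r j) := fun J hJ F =>
      Finset.prod_congr rfl fun j hj => by rw [hR j (hJ hj)]
    unfold pairBracket
    rw [pairConfig_left, pairConfig_right r hpq, hcongr _ Finset.sdiff_subset (pairFactor δ _),
      hcongr _ Finset.sdiff_subset (pairFactor δ _), hcongr _ hI (pairFactor δ · _),
      hcongr _ hI (pairFactor δ · _), hpF, hqF]
    ring
  have hsum := tendsto_finsetSum R.powerset fun I hI =>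
    (hbr I (Finset.mem_powerset.1 hI)).const_mul (b ^ #I * splitWeight δ r R I)
  simp only [mul_zero, Finset.sum_const_zero] at hsum
  refine hsum.congr fun v => ?_
  rw [splitSum_insert_insert _ _ _ hpq hp hq]
  refine Finset.sum_congr rfl fun I hI => ?_
  rw [Finset.mem_powerset] at hI
  have : splitWeight δ (pairConfig r p q s v) R I = splitWeight δ r R I :=
    Finset.prod_congr rfl fun i hi => Finset.prod_congr rfl fun j hj => by
      rw [hR i (hI hi), hR j (Finset.mem_sdiff.1 hj).1]
  rw [this]

theorem SqDistinct.insert {x : ι → ℂ} {a : ι} {R : Finset ι} (hR : SqDistinct x R)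
    (ha : ∀ i ∈ R, x a ^ 2 ≠ x i ^ 2) : SqDistinct x (insert a R) := by
  intro i hi j hj hij
  rw [Finset.mem_insert] at hi hj
  rcases hi with rfl | hi <;> rcases hj with rfl | hj
  · exact absurd rfl hij
  · exact ha j hj
  · exact (ha i hi).symm
  · exact hR i hi j hj hij

/-- Along the line `x e = s / 2 + σ v`, `x f = s / 2 - σ v` (`σ = ±1`) of configurations of total
momentum zero, `splitSum` has no pole where `x e` meets `±r k`. -/
theorem tendsto_mul_splitSum_line {δ b s σ ε v₀ : ℂ} {r : ι → ℂ} {x : ℂ → ι → ℂ} {e f k : ι}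
    {R : Finset ι} (hef : e ≠ f) (he : e ∉ R) (hf : f ∉ R) (hk : k ∈ R)
    (ih : ∀ V : Finset ι, #V = #R → ∀ y : ι → ℂ, SqDistinct y V → ∑ i ∈ V, y i = 0 →
      splitSum δ b y V = 0)
    (hσ : σ = 1 ∨ σ = -1) (hxe : ∀ v, x v e = s / 2 + σ * v)
    (hxf : ∀ v, x v f = s / 2 - σ * v) (hxR : ∀ i ∈ R, ∀ v, x v i = r i)
    (hs : s + ∑ i ∈ R, r i = 0) (hr : SqDistinct r R) (hr0 : ∀ i ∈ R, r i ≠ 0)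
    (hgen : ∀ i ∈ R, ∀ j ∈ R, ∀ η η' : ℂ, (η = 1 ∨ η = -1) → (η' = 1 ∨ η' = -1) →
      s ≠ η * r i + η' * r j)
    (hε : ε = 1 ∨ ε = -1) (hv₀ : s / 2 + σ * v₀ = ε * r k) :
    Tendsto (fun v => (v - v₀) * splitSum δ b (x v) (insert e (insert f R))) (𝓝[≠] v₀)
      (𝓝 0) := by
  have hσσ : σ * σ = 1 := by rcases hσ with h | h <;> simp [h]
  have hkf : k ≠ f := ne_of_mem_of_not_mem hk hf
  have hke : k ≠ e := ne_of_mem_of_not_mem hk he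
  have hset : insert f R = insert k (insert f (R.erase k)) := by
    rw [Finset.insert_comm, Finset.insert_erase hk]
  have hcont : ∀ i ∈ insert e (insert f R), Continuous fun v => x v i := by
    intro i hi
    rw [Finset.mem_insert, Finset.mem_insert] at hi
    rcases hi with rfl | rfl | hi
    · simp only [hxe]
      fun_prop
    · simp only [hxf]
      fun_prop
    · simp only [hxR i hi]
      fun_prop
  have hdist : SqDistinct (x v₀) (insert f R) := by
    refine (hr.congr fun i hi => hxR i hi v₀).insert fun i hi => ?_
    rw [hxf, hxR i hi]
    intro h
    rcases sq_eq_sq_iff_eq_or_eq_neg.1 h with h | h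
    · exact hgen k hk i hi ε 1 hε (Or.inl rfl) (by linear_combination hv₀ + h)
    · exact hgen k hk i hi ε (-1) hε (Or.inr rfl) (by linear_combination hv₀ + h)
  have hdiff : ∀ v, x v e - ε * x v k = σ * (v - v₀) := fun v => by
    rw [hxe, hxR k hk]
    linear_combination hv₀
  have hσ0 : σ ≠ 0 := fun h => by simp [h] at hσσ
  have h := tendsto_mul_splitSum_zero (δ := δ) (b := b) (ε := ε) (x := x) (x₀ := x v₀)
    (l := 𝓝[≠] v₀) (p := e) (q := k) (R := insert f (R.erase k)) hke.symm
    (by simp [hef, he]) (by simp [hkf])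
    (fun i hi => ((hcont i (by rwa [hset])).tendsto v₀).mono_left nhdsWithin_le_nhds)
    (hset ▸ hdist) (by rw [hxR k hk]; exact hr0 k hk) (by rw [hxe, hxR k hk, hv₀])
    (by
      filter_upwards [self_mem_nhdsWithin] with v hv
      rw [hdiff]
      exact mul_ne_zero hσ0 (sub_ne_zero.2 hv))
    (hε.imp_right fun hε' => ⟨hε', ih _ (by
        rw [Finset.card_insert_of_notMem (by simp [hf]), Finset.card_erase_add_one hk]) _
      (hdist.mono (Finset.insert_subset_insert _ (Finset.erase_subset _ _))) (by
        have h1 : ∑ i ∈ R.erase k, x v₀ i = ∑ i ∈ R.erase k, r i :=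
          Finset.sum_congr rfl fun i hi => hxR i (Finset.mem_of_mem_erase hi) v₀
        have h2 := Finset.add_sum_erase R r hk
        rw [Finset.sum_insert (by simp [hf]), h1, hxf]
        rw [hε'] at hv₀
        linear_combination hs + h2 - hv₀)⟩)
  rw [← hset] at h
  have h' := h.const_mul σ
  rw [mul_zero] at h'
  refine h'.congr fun v => ?_
  rw [hdiff]
  linear_combination ((v - v₀) * splitSum δ b (x v) (insert e (insert f R))) * hσσ

/-- Vanishing of `splitSum` for a generic configuration of total momentum zero, given vanishing
for two points fewer. -/
theorem splitSum_pairConfig_eq_zero {δ b : ℂ} (hb : 1 + b ^ 2 + b * (2 + δ ^ 2) = 0)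
    {r : ι → ℂ} {p q : ι} {R : Finset ι} {s v : ℂ} (hpq : p ≠ q) (hp : p ∉ R) (hq : q ∉ R)
    (hRne : R.Nonempty)
    (ih : ∀ V : Finset ι, #V = #R → ∀ y : ι → ℂ, SqDistinct y V → ∑ i ∈ V, y i = 0 →
      splitSum δ b y V = 0)
    (hs : s + ∑ i ∈ R, r i = 0) (hr : SqDistinct r R) (hr0 : ∀ i ∈ R, r i ≠ 0)
    (hgen : ∀ i ∈ R, ∀ j ∈ R, ∀ η η' : ℂ, (η = 1 ∨ η = -1) → (η' = 1 ∨ η' = -1) →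
      s ≠ η * r i + η' * r j)
    (hv : SqDistinct (pairConfig r p q s v) (insert p (insert q R))) :
    splitSum δ b (pairConfig r p q s v) (insert p (insert q R)) = 0 := by
  have hs0 : s ≠ 0 := by
    obtain ⟨k, hk⟩ := hRne
    simpa using hgen k hk k hk 1 (-1) (Or.inl rfl) (Or.inr rfl)
  have hL : ∀ w, pairConfig r p q s w p = s / 2 + w := pairConfig_left r p q s
  have hM : ∀ w, pairConfig r p q s w q = s / 2 - w := pairConfig_right r hpq s
  have hR : ∀ i ∈ R, ∀ w, pairConfig r p q s w i = r i := fun i hi w =>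
    pairConfig_of_ne r (ne_of_mem_of_not_mem hi hp) (ne_of_mem_of_not_mem hi hq) s w
  set P : Finset ℂ := {0} ∪ R.image (fun k => r k - s / 2) ∪ R.image (fun k => -r k - s / 2) ∪
    R.image (fun k => s / 2 - r k) ∪ R.image (fun k => s / 2 + r k) with hPdef
  have hP : ∀ w, w ∈ P ↔ w = 0 ∨ ∃ k ∈ R, (s / 2 + w) ^ 2 = r k ^ 2 ∨
      (s / 2 - w) ^ 2 = r k ^ 2 := by
    intro w
    simp only [hPdef, Finset.mem_union, Finset.mem_singleton, Finset.mem_image,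
      sq_eq_sq_iff_eq_or_eq_neg]
    constructor
    · rintro ((((h | ⟨k, hk, rfl⟩) | ⟨k, hk, rfl⟩) | ⟨k, hk, rfl⟩) | ⟨k, hk, rfl⟩)
      · exact Or.inl h
      · exact Or.inr ⟨k, hk, Or.inl (Or.inl (by ring))⟩
      · exact Or.inr ⟨k, hk, Or.inl (Or.inr (by ring))⟩
      · exact Or.inr ⟨k, hk, Or.inr (Or.inl (by ring))⟩
      · exact Or.inr ⟨k, hk, Or.inr (Or.inr (by ring))⟩
    · rintro (h | ⟨k, hk, (h | h) | (h | h)⟩)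
      · exact Or.inl (Or.inl (Or.inl (Or.inl h)))
      · exact Or.inl (Or.inl (Or.inl (Or.inr ⟨k, hk, by linear_combination -h⟩)))
      · exact Or.inl (Or.inl (Or.inr ⟨k, hk, by linear_combination -h⟩))
      · exact Or.inl (Or.inr ⟨k, hk, by linear_combination h⟩)
      · exact Or.inr ⟨k, hk, by linear_combination h⟩
  refine eq_zero_of_removable_of_tendsto_cobounded P
    (fun w => splitSum δ b (pairConfig r p q s w) (insert p (insert q R))) ?_ ?_
    (tendsto_splitSum_pairConfig hb hpq hp hq hs hs0) v ?_
  · intro w hw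
    rw [hP, not_or] at hw
    obtain ⟨hw0, hw⟩ := hw
    push Not at hw
    refine differentiableAt_splitSum ?_ (SqDistinct.insert (SqDistinct.insert
      (hr.congr fun i hi => hR i hi w) fun i hi => ?_) fun i hi => ?_)
    · intro i hi
      rw [Finset.mem_insert, Finset.mem_insert] at hi
      rcases hi with rfl | rfl | hi
      · simp only [hL]
        fun_prop
      · simp only [hM]
        fun_prop
      · simp only [hR i hi]
        fun_prop
    · rw [hM, hR i hi]
      exact (hw i hi).2
    · rw [Finset.mem_insert] at hi
      rcases hi with rfl | hi
      · rw [hL, hM]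
        intro h
        exact mul_ne_zero hs0 hw0 (by linear_combination h / 2)
      · rw [hL, hR i hi]
        exact (hw i hi).1
  · intro w hw
    rw [hP] at hw
    rcases hw with rfl | ⟨k, hk, h | h⟩
    · have hcont : ∀ i ∈ insert p (insert q R), Continuous fun w => pairConfig r p q s w i := by
        intro i hi
        rw [Finset.mem_insert, Finset.mem_insert] at hi
        rcases hi with rfl | rfl | hi
        · simp only [hL]
          fun_prop
        · simp only [hM]
          fun_prop
        · simp only [hR i hi]
          fun_prop
      have h := tendsto_mul_splitSum_zero (δ := δ) (b := b) (ε := 1) (l := 𝓝[≠] (0 : ℂ))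
        (x := pairConfig r p q s) (x₀ := pairConfig r p q s 0) hpq hp hq
        (fun i hi => ((hcont i hi).tendsto 0).mono_left nhdsWithin_le_nhds)
        (SqDistinct.insert (hr.congr fun i hi => hR i hi 0) fun i hi h => by
          rw [hM, hR i hi, sub_zero, sq_eq_sq_iff_eq_or_eq_neg] at h
          rcases h with h | h
          · exact hgen i hi i hi 1 1 (Or.inl rfl) (Or.inl rfl) (by linear_combination 2 * h)
          · exact hgen i hi i hi (-1) (-1) (Or.inr rfl) (Or.inr rfl)
              (by linear_combination 2 * h))
        (by rw [hM]; simpa using hs0) (by rw [hL, hM]; ring)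
        (by
          filter_upwards [self_mem_nhdsWithin] with w hw
          rw [hL, hM]
          have : s / 2 + w - 1 * (s / 2 - w) = 2 * w := by ring
          rw [this]
          exact mul_ne_zero two_ne_zero hw)
        (Or.inl rfl)
      have h' := h.const_mul (1 / 2)
      rw [mul_zero] at h'
      refine h'.congr fun w => ?_
      rw [hL, hM]
      ring
    · obtain ⟨ε, hε, h⟩ : ∃ ε : ℂ, (ε = 1 ∨ ε = -1) ∧ s / 2 + 1 * w = ε * r k := by
        rcases sq_eq_sq_iff_eq_or_eq_neg.1 h with h | h
        · exact ⟨1, Or.inl rfl, by linear_combination h⟩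
        · exact ⟨-1, Or.inr rfl, by linear_combination h⟩
      exact tendsto_mul_splitSum_line hpq hp hq hk ih (Or.inl rfl)
        (fun w => by rw [hL, one_mul]) (fun w => by rw [hM, one_mul]) hR hs hr hr0 hgen hε h
    · obtain ⟨ε, hε, h⟩ : ∃ ε : ℂ, (ε = 1 ∨ ε = -1) ∧ s / 2 + -1 * w = ε * r k := by
        rcases sq_eq_sq_iff_eq_or_eq_neg.1 h with h | h
        · exact ⟨1, Or.inl rfl, by linear_combination h⟩
        · exact ⟨-1, Or.inr rfl, by linear_combination h⟩
      rw [Finset.insert_comm]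
      exact tendsto_mul_splitSum_line hpq.symm hq hp hk ih (Or.inr rfl)
        (fun w => by rw [hM]; ring) (fun w => by rw [hL]; ring) hR hs hr hr0 hgen hε h
  · rw [hP]
    rintro (rfl | ⟨k, hk, h | h⟩)
    · refine hv p (by simp) q (by simp) hpq ?_
      rw [hL, hM, add_zero, sub_zero]
    · exact hv p (by simp) k (by simp [hk]) (ne_of_mem_of_not_mem hk hp).symm
        (by rw [hL, hR k hk, h])
    · exact hv q (by simp) k (by simp [hk]) (ne_of_mem_of_not_mem hk hq).symm
        (by rw [hM, hR k hk, h])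

/-- Vanishing of `splitSum` for three points of total momentum zero. -/
theorem splitSum_eq_zero_of_card_eq_three {δ b : ℂ} (hb : 1 + b ^ 2 + b * (2 + δ ^ 2) = 0)
    {U : Finset ι} (hU : #U = 3) {x : ι → ℂ} (hx : SqDistinct x U) (hsum : ∑ i ∈ U, x i = 0) :
    splitSum δ b x U = 0 := by
  obtain ⟨p, q, k, hpq, hpk, hqk, rfl⟩ := Finset.card_eq_three.1 hU
  have h1 := hx p (by simp) q (by simp) hpq
  have h2 := hx p (by simp) k (by simp) hpk
  have h3 := hx q (by simp) k (by simp) hqk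
  have hk : x k = -x p - x q := by
    rw [Finset.sum_insert (by simp [hpq, hpk]), Finset.sum_pair hqk] at hsum
    linear_combination hsum
  rw [splitSum_insert_insert δ b x hpq (by simpa using hpk) (by simpa using hqk),
    ← insert_empty_eq k, Finset.sum_powerset_insert (by simp)]
  simp only [splitWeight, pairBracket, Finset.powerset_empty, Finset.sum_singleton,
    Finset.card_empty, Finset.prod_empty, insert_empty_eq, Finset.sdiff_empty, Finset.sdiff_self,
    Finset.prod_singleton, Finset.card_singleton, pow_zero, pow_one, mul_one, one_mul]
  rw [hk] at h2 h3 ⊢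
  generalize x p = y at *
  generalize x q = z at *
  have e1 : y - z ≠ 0 := fun h => h1 (by linear_combination (y + z) * h)
  have e2 : y + z ≠ 0 := fun h => h1 (by linear_combination (y - z) * h)
  have e3 : z ≠ 0 := fun h => h2 (by rw [h]; ring)
  have e4 : y * 2 + z ≠ 0 := fun h => h2 (by linear_combination (-z) * h)
  have e5 : y ≠ 0 := fun h => h3 (by rw [h]; ring)
  have e6 : y + z * 2 ≠ 0 := fun h => h3 (by linear_combination (-y) * h)
  have f1 : pairFactor δ y z = 1 + δ * y * z / ((y - z) * (y + z)) := by
    rw [pairFactor]; congr 2; ring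
  have f2 : pairFactor δ z y = 1 - δ * y * z / ((y - z) * (y + z)) := by
    rw [pairFactor, sub_eq_add_neg 1, ← div_neg]; congr 2 <;> ring
  have f3 : pairFactor δ y (-y - z) = 1 + δ * y * (y + z) / (z * (y * 2 + z)) := by
    rw [pairFactor, ← neg_div_neg_eq]; congr 2 <;> ring
  have f4 : pairFactor δ (-y - z) y = 1 - δ * y * (y + z) / (z * (y * 2 + z)) := by
    rw [pairFactor, sub_eq_add_neg 1, ← neg_div]; congr 2 <;> ring
  have f5 : pairFactor δ z (-y - z) = 1 + δ * z * (y + z) / (y * (y + z * 2)) := by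
    rw [pairFactor, ← neg_div_neg_eq]; congr 2 <;> ring
  have f6 : pairFactor δ (-y - z) z = 1 - δ * z * (y + z) / (y * (y + z * 2)) := by
    rw [pairFactor, sub_eq_add_neg 1, ← neg_div]; congr 2 <;> ring
  have hAC : δ * y * z / ((y - z) * (y + z)) * (δ * y * (y + z) / (z * (y * 2 + z))) -
      δ * y * z / ((y - z) * (y + z)) * (δ * z * (y + z) / (y * (y + z * 2))) +
      δ * y * (y + z) / (z * (y * 2 + z)) * (δ * z * (y + z) / (y * (y + z * 2))) = δ ^ 2 := by
    field_simp
    ring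
  rw [f1, f2, f3, f4, f5, f6]
  linear_combination (1 + b) * hb + (b + b ^ 2) * hAC

end SplitSum

theorem eventually_sum_mul_add_pow_ne_zero {M : ℕ} (R : Finset (Fin M)) (a r : Fin M → ℂ)
    (ha : ∃ k ∈ R, a k ≠ 0) :
    ∀ᶠ t : ℂ in 𝓝[≠] 0, ∑ k ∈ R, a k * (r k + t ^ ((k : ℕ) + 1)) ≠ 0 := by
  obtain ⟨m, hm, ham⟩ := ha
  set Q : Polynomial ℂ := ∑ k ∈ R, Polynomial.C (a k) *
    (Polynomial.C (r k) + Polynomial.X ^ ((k : ℕ) + 1)) with hQ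
  have hcoeff : Q.coeff (m + 1) = a m := by
    rw [hQ, Polynomial.finsetSum_coeff, Finset.sum_eq_single m]
    · simp
    · intro k _ hk
      have : (m : ℕ) ≠ k := fun h => hk (Fin.ext h.symm)
      simp [Polynomial.coeff_X_pow, this]
    · exact fun h => absurd hm h
  have hQ0 : Q ≠ 0 := fun h => ham (by rw [← hcoeff, h, Polynomial.coeff_zero])
  have hmem : ((Q.roots.toFinset.erase 0 : Finset ℂ) : Set ℂ)ᶜ ∈ 𝓝 (0 : ℂ) :=
    (Finset.finite_toSet _).isClosed.isOpen_compl.mem_nhds (by simp)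
  filter_upwards [nhdsWithin_le_nhds hmem, self_mem_nhdsWithin] with t ht ht0 h
  refine ht ?_
  have heval : Q.eval t = 0 := by
    rw [← h, hQ, Polynomial.eval_finsetSum]
    simp
  simp only [Finset.mem_coe, Finset.mem_erase, Multiset.mem_toFinset,
    Polynomial.mem_roots hQ0, Polynomial.IsRoot.def]
  exact ⟨ht0, heval⟩

theorem eventually_sqDistinct {ι α : Type*} {l : Filter α} {x : α → ι → ℂ} {x₀ : ι → ℂ}
    {U : Finset ι} (hx : ∀ i ∈ U, Tendsto (fun t => x t i) l (𝓝 (x₀ i)))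
    (hU : SqDistinct x₀ U) : ∀ᶠ t in l, SqDistinct (x t) U := by
  refine (Finset.eventually_all U).2 fun i hi => (Finset.eventually_all U).2 fun j hj => ?_
  by_cases hij : i = j
  · exact Eventually.of_forall fun t h => absurd hij h
  · filter_upwards [(((hx i hi).pow 2).sub ((hx j hj).pow 2)).eventually_ne
      (sub_ne_zero.2 (hU i hi j hj hij))] with t ht _
    exact sub_ne_zero.1 ht

/-- Vanishing of `splitSum` at zero total momentum for every odd number of at least three points. -/
theorem splitSum_eq_zero {δ b : ℂ} (hb : 1 + b ^ 2 + b * (2 + δ ^ 2) = 0) {M : ℕ} (n : ℕ)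
    (U : Finset (Fin M)) (hU : #U = 2 * n + 3) (x : Fin M → ℂ) (hx : SqDistinct x U)
    (hsum : ∑ i ∈ U, x i = 0) : splitSum δ b x U = 0 := by
  induction n generalizing U x with
  | zero => exact splitSum_eq_zero_of_card_eq_three hb hU hx hsum
  | succ n ih =>
    obtain ⟨p, hpU⟩ : U.Nonempty := Finset.card_pos.1 (by omega)
    obtain ⟨q, hqU⟩ : (U.erase p).Nonempty :=
      Finset.card_pos.1 (by rw [Finset.card_erase_of_mem hpU]; omega)
    obtain ⟨R, hRdef⟩ : ∃ R, R = (U.erase p).erase q := ⟨_, rfl⟩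
    have hUR : U = insert p (insert q R) := by
      rw [hRdef, Finset.insert_erase hqU, Finset.insert_erase hpU]
    have hpq : p ≠ q := (Finset.ne_of_mem_erase hqU).symm
    have hp : p ∉ R := by simp [hRdef]
    have hq : q ∉ R := by simp [hRdef]
    have hcard : #R = 2 * n + 3 := by
      rw [hRdef, Finset.card_erase_of_mem hqU, Finset.card_erase_of_mem hpU]
      omega
    subst hUR
    rw [Finset.sum_insert (by simp [hpq, hp]), Finset.sum_insert hq] at hsum
    let r : ℂ → Fin M → ℂ := fun t k => x k + t ^ ((k : ℕ) + 1)
    let s : ℂ → ℂ := fun t => -∑ k ∈ R, r t k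
    let y : ℂ → Fin M → ℂ := fun t => pairConfig (r t) p q (s t) (s t / 2 - x q)
    have hs : ∀ t, s t + ∑ k ∈ R, r t k = 0 := fun t => neg_add_cancel _
    have hyR : ∀ i ∈ R, ∀ t, y t i = r t i := fun i hi t =>
      pairConfig_of_ne _ (ne_of_mem_of_not_mem hi hp) (ne_of_mem_of_not_mem hi hq) _ _
    have hrt : ∀ i, Tendsto (fun t => r t i) (𝓝[≠] 0) (𝓝 (x i)) := fun i => by
      have : Tendsto (fun t => r t i) (𝓝 0) (𝓝 (r 0 i)) :=
        Continuous.tendsto (by simp only [r]; fun_prop) 0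
      simp only [r, zero_pow (Nat.succ_ne_zero _), add_zero] at this
      exact this.mono_left nhdsWithin_le_nhds
    have hst : Tendsto s (𝓝[≠] 0) (𝓝 (x p + x q)) := by
      have := (tendsto_finsetSum R fun i _ => hrt i).neg
      rwa [show -∑ i ∈ R, x i = x p + x q by linear_combination -hsum] at this
    have hyt : ∀ i ∈ insert p (insert q R), Tendsto (fun t => y t i) (𝓝[≠] 0) (𝓝 (x i)) := by
      intro i hi
      rw [Finset.mem_insert, Finset.mem_insert] at hi
      rcases hi with rfl | rfl | hi
      · have h := hst.sub_const (x q)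
        rw [add_sub_cancel_right] at h
        refine h.congr fun t => ?_
        simp only [y, pairConfig_left]
        ring
      · refine tendsto_const_nhds.congr fun t => ?_
        simp only [y, pairConfig_right _ hpq]
        ring
      · simp only [hyR i hi]
        exact hrt i
    have hr : ∀ᶠ t in 𝓝[≠] 0, SqDistinct (r t) R := eventually_sqDistinct (fun i _ => hrt i)
      (hx.mono fun i hi => by simp [hi])
    have hr0 : ∀ᶠ t in 𝓝[≠] 0, ∀ i ∈ R, r t i ≠ 0 := by
      refine (Finset.eventually_all R).2 fun i hi => ?_
      filter_upwards [eventually_sum_mul_add_pow_ne_zero R (Pi.single i 1) x ⟨i, hi, by simp⟩]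
        with t ht
      simpa [Pi.single_apply, hi] using ht
    have hgen : ∀ η η' : ℂ, ∀ᶠ t in 𝓝[≠] 0, ∀ i ∈ R, ∀ j ∈ R,
        s t ≠ η * r t i + η' * r t j := by
      intro η η'
      refine (Finset.eventually_all R).2 fun i hi => (Finset.eventually_all R).2 fun j hj => ?_
      obtain ⟨m, hm⟩ : ((R.erase i).erase j).Nonempty := by
        have h1 := Finset.pred_card_le_card_erase (s := R) (a := i)
        have h2 := Finset.pred_card_le_card_erase (s := R.erase i) (a := j)
        exact Finset.card_pos.1 (by omega)
      simp only [Finset.mem_erase] at hm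
      filter_upwards [eventually_sum_mul_add_pow_ne_zero R
        (fun k => 1 + Pi.single (M := fun _ => ℂ) i η k + Pi.single (M := fun _ => ℂ) j η' k) x
        ⟨m, hm.2.2, by simp [hm.1, hm.2.1]⟩] with t ht h
      refine ht ?_
      simp only [add_mul, one_mul, Finset.sum_add_distrib, Pi.single_apply, ite_mul, zero_mul,
        Finset.sum_ite_eq', hi, hj, if_true]
      have h3 := hs t
      simp only [r, Finset.sum_add_distrib] at h h3
      linear_combination h3 - h
    have hzero : ∀ᶠ t in 𝓝[≠] 0, splitSum δ b (y t) (insert p (insert q R)) = 0 := by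
      filter_upwards [hr, hr0, eventually_sqDistinct hyt hx, hgen 1 1, hgen 1 (-1),
        hgen (-1) 1, hgen (-1) (-1)] with t h1 h2 h3 h4 h5 h6 h7
      refine splitSum_pairConfig_eq_zero hb hpq hp hq (Finset.card_pos.1 (by omega))
        (fun V hV => ih V (hV.trans hcard)) (hs t) h1 h2 ?_ h3
      rintro i hi j hj η η' (rfl | rfl) (rfl | rfl)
      · exact h4 i hi j hj
      · exact h5 i hi j hj
      · exact h6 i hi j hj
      · exact h7 i hi j hj
    exact tendsto_nhds_unique ((tendsto_splitSum hyt hx).congr' hzero) tendsto_const_nhds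

theorem ff_div_eq_pairFactor {ω a b : ℂ} (hω : ω ≠ 0) (hb : b ≠ 0) (hab : a ^ 2 ≠ b ^ 2) :
    ff ω (a / b) = pairFactor (ω - ω⁻¹) a b := by
  have h : a ^ 2 - b ^ 2 ≠ 0 := sub_ne_zero.2 hab
  have h' : (a / b) ^ 2 - 1 = (a ^ 2 - b ^ 2) / b ^ 2 := by field_simp
  rw [ff, pairFactor, h']
  field_simp
  ring

theorem Admissible.sqDistinct {N : ℕ} {X : Fin N → ℂ} (h : Admissible X) (U : Finset (Fin N)) :
    SqDistinct X U := fun i _ j _ hij hsq =>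
  (sq_eq_sq_iff_eq_or_eq_neg.1 hsq).elim (h.2 i j hij).1 (h.2 i j hij).2

theorem Jtilde_eq_splitSum {ω : ℂ} (hω : ω ≠ 0) {N : ℕ} {X : Fin N → ℂ} (hX : Admissible X) :
    Jtilde ω X = (-(Complex.I * ω)) ^ (-(N : ℤ)) *
      splitSum (ω - ω⁻¹) (-ω ^ 2) X Finset.univ := by
  have h0 : -(Complex.I * ω) ≠ 0 := neg_ne_zero.2 (mul_ne_zero Complex.I_ne_zero hω)
  have hsq : (-(Complex.I * ω)) ^ 2 = -ω ^ 2 := by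
    rw [neg_sq, mul_pow, Complex.I_sq, neg_one_mul]
  rw [Jtilde, splitSum, Finset.powerset_univ, Finset.mul_sum]
  refine Finset.sum_congr rfl fun I _ => ?_
  have hpow : (-(Complex.I * ω)) ^ (2 * (#I : ℤ) - (N : ℤ)) =
      (-(Complex.I * ω)) ^ (-(N : ℤ)) * (-ω ^ 2) ^ #I := by
    rw [sub_eq_neg_add, zpow_add₀ h0, zpow_mul, zpow_natCast]
    congr 2
  rw [hpow, mul_assoc, splitWeight, ← Finset.compl_eq_univ_sdiff]
  congr 2
  refine Finset.prod_congr rfl fun i hi => Finset.prod_congr rfl fun j hj => ?_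
  exact ff_div_eq_pairFactor hω (hX.1 j) (hX.sqDistinct Finset.univ i (by simp) j (by simp)
    fun h => Finset.mem_compl.1 hj (h ▸ hi))

/-- vanishing on the zero-momentum hyperplane at the reduction point: for odd
`N` and admissible `X` with `x_1 + … + x_N = 0`, we have `J̃_N(X) = 0`. -/
theorem stmt16 (ω : ℂ) (hω : ω ≠ 0 ∧ ω ≠ 1 ∧ ω ≠ -1)
    (N : ℕ) (hN : Odd N) (X : Fin N → ℂ) (hadm : Admissible X)
    (hsum : ∑ i : Fin N, X i = 0) :
    Jtilde ω X = 0 := by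
  obtain ⟨m, rfl⟩ := hN
  rcases m with _ | n
  · exact absurd (by simpa using hsum) (hadm.1 0)
  · have hω0 := hω.1
    rw [Jtilde_eq_splitSum hω0 hadm, splitSum_eq_zero _ n Finset.univ (by simp; ring) X
      (hadm.sqDistinct _) hsum, mul_zero]
    field_simp
    ring
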